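/- arXiv:2602.17506 — 6 statements merged into one kernel-verified Lean document; each statement's English description precedes it below -/
import Mathlib

section
/- For every energy h and every initial point (s0,v0,u0,w0) with 0 <= s0 <= 1 and E(s0,v0,u0,w0) = 0, there exists a solution (s,v,u,w) of the regularized blown-up system defined for all tau in R with (s(0),v(0),u(0),w(0)) = (s0,v0,u0,w0) and 0 <= s(tau) <= 1 for all tau; that is, solutions of the regularized system on the energy level never blow up in finite time. -/
open Real Filter Topology MeasureTheory

/-- The regularized shape potential `W(u)` of the isosceles three-body problem with
masses `m1 = m2 = 1`, `m3`, where `mu = 2*m3/(2+m3)`. -/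
noncomputable def Wpot (m3 u : ℝ) : ℝ :=
  1 / Real.sqrt 2 +
    2 * m3 * Real.cos u ^ 2 /
      Real.sqrt (Real.cos u ^ 4 / 2 + (1 - Real.cos u ^ 4) / (2 * m3 / (2 + m3)))

/-- The energy function `E(s,v,u,w)` for energy `h`. -/
noncomputable def energyFn (m3 h s v u w : ℝ) : ℝ :=
  1 / 2 * (v ^ 2 * Real.cos u ^ 2 + w ^ 2) - (1 - s) * Wpot m3 u - h * s * Real.cos u ^ 2

/-- `(s,v,u,w) : ℝ → ℝ` is a (globally defined) solution of the regularized blown-up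
system of the isosceles three-body problem with mass `m3` and energy `h`. -/
def IsSolution (m3 h : ℝ) (s v u w : ℝ → ℝ) : Prop :=
  (∀ τ : ℝ, HasDerivAt s (v τ * s τ * (1 - s τ) * Real.cos (u τ) ^ 2) τ) ∧
  (∀ τ : ℝ, HasDerivAt v (1 / 2 * (1 - s τ) * v τ ^ 2 * Real.cos (u τ) ^ 2 + w τ ^ 2
      - (1 - s τ) * Wpot m3 (u τ)) τ) ∧
  (∀ τ : ℝ, HasDerivAt u (1 / 2 * Real.sqrt (1 + Real.cos (u τ) ^ 2) * w τ) τ) ∧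
  (∀ τ : ℝ, HasDerivAt w (-(1 / 2) * (1 + s τ) * v τ * w τ * Real.cos (u τ) ^ 2
      + 1 / 2 * Real.sqrt (1 + Real.cos (u τ) ^ 2) * (1 - s τ) * deriv (Wpot m3) (u τ)
      + 1 / 2 * (v τ ^ 2 - 2 * h * s τ) * Real.sqrt (1 + Real.cos (u τ) ^ 2)
          * Real.sin (u τ) * Real.cos (u τ)) τ)

/-- The solution satisfies the energy relation `E = 0` at all times. -/
def SatisfiesEnergy (m3 h : ℝ) (s v u w : ℝ → ℝ) : Prop :=
  ∀ τ : ℝ, energyFn m3 h (s τ) (v τ) (u τ) (w τ) = 0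

section GlobalFlow

variable {E : Type*} [NormedAddCommGroup E] [NormedSpace ℝ E]

/-- Solutions of an autonomous `C¹` equation on all symmetric intervals glue to a global one. -/
lemma exists_hasDerivAt_of_forall_Ioo [CompleteSpace E] {f : E → E} (hf : ContDiff ℝ 1 f) (x : E)
    (h : ∀ T : ℝ, ∃ γ : ℝ → E, γ 0 = x ∧ ∀ t ∈ Set.Ioo (-T) T, HasDerivAt γ (f (γ t)) t) :
    ∃ γ : ℝ → E, γ 0 = x ∧ ∀ t, HasDerivAt γ (f (γ t)) t := by
  have key := (exists_isMIntegralCurve_iff_exists_isMIntegralCurveOn_Ioo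
    (I := modelWithCornersSelf ℝ E) (M := E) (v := f)
    (contMDiff_vectorSpace_iff_contDiff.2 hf) x).2 fun T ↦ by
      obtain ⟨γ, h0, hγ⟩ := h T
      exact ⟨γ, h0, fun t ht ↦ (hγ t ht).hasFDerivAt.hasMFDerivAt.hasMFDerivWithinAt⟩
  obtain ⟨γ, h0, hγ⟩ := key
  refine ⟨γ, h0, fun t ↦ ?_⟩
  have hd : HasFDerivAt γ ((1 : ℝ →L[ℝ] ℝ).smulRight (f (γ t))) t := (hγ t).hasFDerivAt
  exact hd.hasDerivAt.congr_deriv (one_smul ℝ _)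

/-- A compactly supported `C¹` vector field is complete. -/
lemma exists_hasDerivAt_of_hasCompactSupport [CompleteSpace E] {f : E → E} (hf : ContDiff ℝ 1 f)
    (hc : HasCompactSupport f) (x : E) :
    ∃ γ : ℝ → E, γ 0 = x ∧ ∀ t, HasDerivAt γ (f (γ t)) t := by
  refine exists_hasDerivAt_of_forall_Ioo hf x fun T ↦ ?_
  obtain hT | hT := le_or_gt T 0
  · exact ⟨fun _ ↦ x, rfl, fun t ht ↦ by linarith [ht.1, ht.2]⟩
  obtain ⟨K, hK⟩ := ContDiff.lipschitzWith_of_hasCompactSupport hc hf one_ne_zero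
  obtain ⟨M, hM⟩ := hc.exists_bound_of_continuous hf.continuous
  lift M to NNReal using (norm_nonneg _).trans (hM x)
  have hpl : IsPicardLindelof (fun _ ↦ f) (tmin := -T) (tmax := T)
      ⟨0, by linarith, hT.le⟩ x (M * T.toNNReal) 0 M K :=
    { lipschitzOnWith := fun _ _ ↦ hK.lipschitzOnWith
      continuousOn := fun _ _ ↦ continuousOn_const
      norm_le := fun _ _ y _ ↦ hM y
      mul_max_le := by simp [hT.le] }
  obtain ⟨γ, h0, hγ⟩ := hpl.exists_eq_forall_mem_Icc_hasDerivWithinAt₀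
  exact ⟨γ, h0, fun t ht ↦
    (hγ t (Set.Ioo_subset_Icc_self ht)).hasDerivAt (Icc_mem_nhds ht.1 ht.2)⟩

/-- If every cutoff of a `C¹` vector field by a factor in `[0, 1]` only has solutions obeying an
a priori bound that is uniform on bounded time intervals, then the field itself has a global
solution with the given initial value. -/
lemma exists_hasDerivAt_of_cutoff_bound [FiniteDimensional ℝ E] {f : E → E} (hf : ContDiff ℝ 1 f)
    (x : E)
    (hb : ∀ T : ℝ, ∃ R : ℝ, ∀ (φ : E → ℝ) (γ : ℝ → E), Continuous φ →
      (∀ y, 0 ≤ φ y ∧ φ y ≤ 1) → γ 0 = x → (∀ t, HasDerivAt γ (φ (γ t) • f (γ t)) t) →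
      ∀ t ∈ Set.Ioo (-T) T, ‖γ t‖ ≤ R) :
    ∃ γ : ℝ → E, γ 0 = x ∧ ∀ t, HasDerivAt γ (f (γ t)) t := by
  have : CompleteSpace E := FiniteDimensional.complete ℝ E
  refine exists_hasDerivAt_of_forall_Ioo hf x fun T ↦ ?_
  obtain ⟨R, hR⟩ := hb T
  let φ : ContDiffBump (0 : E) := ⟨|R| + 1, |R| + 2, by positivity, by linarith⟩
  obtain ⟨γ, h0, hγ⟩ := exists_hasDerivAt_of_hasCompactSupport (f := fun y ↦ φ y • f y)
    (φ.contDiff.smul hf) φ.hasCompactSupport.smul_right x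
  refine ⟨γ, h0, fun t ht ↦ ?_⟩
  have hmem : γ t ∈ Metric.closedBall (0 : E) φ.rIn := by
    rw [mem_closedBall_zero_iff]
    have := hR φ γ φ.continuous (fun y ↦ ⟨φ.nonneg, φ.le_one⟩) h0 hγ t ht
    exact this.trans (by simp only [φ]; linarith [le_abs_self R])
  simpa [φ.one_of_mem_closedBall hmem] using hγ t

end GlobalFlow

/-- Solutions of a scalar linear homogeneous equation keep their sign. -/
lemma nonneg_of_hasDerivAt_mul {y a : ℝ → ℝ} (ha : Continuous a)
    (hy : ∀ t, HasDerivAt y (a t * y t) t) (h0 : 0 ≤ y 0) (t : ℝ) : 0 ≤ y t := by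
  have hA : ∀ t, HasDerivAt (fun t ↦ ∫ r in (0 : ℝ)..t, a r) (a t) t := fun t ↦
    intervalIntegral.integral_hasDerivAt_right (ha.intervalIntegrable _ _)
      (ha.stronglyMeasurableAtFilter _ _) ha.continuousAt
  have hz : ∀ t, HasDerivAt (fun t ↦ y t * Real.exp (-∫ r in (0 : ℝ)..t, a r)) 0 t := fun t ↦
    ((hy t).mul (hA t).neg.exp).congr_deriv (by ring)
  have hc := is_const_of_deriv_eq_zero (fun t ↦ (hz t).differentiableAt)
    (fun t ↦ (hz t).deriv) t 0
  simp only [intervalIntegral.integral_same, neg_zero, Real.exp_zero, mul_one] at hc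
  exact nonneg_of_mul_nonneg_left (hc ▸ h0) (Real.exp_pos _)

/-- A function with derivative bounded by `C` grows at most linearly. -/
lemma abs_sub_le_of_abs_deriv_le {y y' : ℝ → ℝ} {C : ℝ} (hy : ∀ t, HasDerivAt y (y' t) t)
    (hC : ∀ t, |y' t| ≤ C) (t : ℝ) : |y t - y 0| ≤ C * |t| := by
  simpa using convex_univ.norm_image_sub_le_of_norm_hasDerivWithin_le
    (fun t _ ↦ (hy t).hasDerivWithinAt) (fun t _ ↦ hC t) (Set.mem_univ 0) (Set.mem_univ t)

lemma contDiff_Wpot {m3 : ℝ} (hm3 : 0 < m3) {n : WithTop ℕ∞} : ContDiff ℝ n (Wpot m3) := by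
  have hpos : ∀ u : ℝ,
      0 < Real.cos u ^ 4 / 2 + (1 - Real.cos u ^ 4) / (2 * m3 / (2 + m3)) := fun u ↦ by
    have h1 : Real.cos u ^ 4 ≤ 1 := by
      have := Real.cos_sq_le_one u
      nlinarith [sq_nonneg (Real.cos u)]
    have hmu : 0 < 2 * m3 / (2 + m3) := by positivity
    have h2 : 0 ≤ (1 - Real.cos u ^ 4) / (2 * m3 / (2 + m3)) := div_nonneg (by linarith) hmu.le
    rcases eq_or_ne (Real.cos u) 0 with hc | hc
    · simp only [hc]; norm_num; positivity
    · have : 0 < Real.cos u ^ 4 := by positivity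
      linarith
  unfold Wpot
  refine contDiff_const.add (ContDiff.div (by fun_prop) (ContDiff.sqrt (by fun_prop) ?_) ?_)
  · exact fun u ↦ (hpos u).ne'
  · exact fun u ↦ (Real.sqrt_pos.2 (hpos u)).ne'

lemma exists_abs_Wpot_le {m3 : ℝ} (hm3 : 0 < m3) : ∃ B : ℝ, ∀ u, |Wpot m3 u| ≤ B := by
  have hper : Function.Periodic (Wpot m3) (2 * π) := fun u ↦ by simp [Wpot]
  obtain ⟨B, hB⟩ := (hper.isBounded_of_continuous (by positivity)
    (contDiff_Wpot hm3 (n := 0)).continuous).exists_norm_le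
  exact ⟨B, fun u ↦ hB _ (Set.mem_range_self u)⟩

/-- The regularized blown-up vector field in the coordinates `(s, v, u, w)`. -/
noncomputable def blownUpField (m3 h : ℝ) (x : ℝ × ℝ × ℝ × ℝ) : ℝ × ℝ × ℝ × ℝ :=
  (x.2.1 * x.1 * (1 - x.1) * Real.cos x.2.2.1 ^ 2,
    1 / 2 * (1 - x.1) * x.2.1 ^ 2 * Real.cos x.2.2.1 ^ 2 + x.2.2.2 ^ 2
      - (1 - x.1) * Wpot m3 x.2.2.1,
    1 / 2 * Real.sqrt (1 + Real.cos x.2.2.1 ^ 2) * x.2.2.2,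
    -(1 / 2) * (1 + x.1) * x.2.1 * x.2.2.2 * Real.cos x.2.2.1 ^ 2
      + 1 / 2 * Real.sqrt (1 + Real.cos x.2.2.1 ^ 2) * (1 - x.1) * deriv (Wpot m3) x.2.2.1
      + 1 / 2 * (x.2.1 ^ 2 - 2 * h * x.1) * Real.sqrt (1 + Real.cos x.2.2.1 ^ 2)
          * Real.sin x.2.2.1 * Real.cos x.2.2.1)

lemma contDiff_blownUpField {m3 : ℝ} (hm3 : 0 < m3) (h : ℝ) :
    ContDiff ℝ 1 (blownUpField m3 h) := by
  have hW : ContDiff ℝ 1 (Wpot m3) := contDiff_Wpot hm3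
  have hW' : ContDiff ℝ 1 (deriv (Wpot m3)) := (contDiff_Wpot hm3 (n := 2)).deriv'
  have hsq : ContDiff ℝ 1 fun x : ℝ × ℝ × ℝ × ℝ ↦ Real.sqrt (1 + Real.cos x.2.2.1 ^ 2) :=
    ContDiff.sqrt (by fun_prop) fun x ↦ by positivity
  unfold blownUpField
  fun_prop

/-- Componentwise form of the equation `x' = φ • blownUpField m3 h x`. -/
structure IsRescaledSolution (m3 h : ℝ) (φ s v u w : ℝ → ℝ) : Prop where
  deriv_s : ∀ τ, HasDerivAt s (φ τ * (v τ * s τ * (1 - s τ) * Real.cos (u τ) ^ 2)) τ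
  deriv_v : ∀ τ, HasDerivAt v (φ τ * (1 / 2 * (1 - s τ) * v τ ^ 2 * Real.cos (u τ) ^ 2 + w τ ^ 2
      - (1 - s τ) * Wpot m3 (u τ))) τ
  deriv_u : ∀ τ, HasDerivAt u (φ τ * (1 / 2 * Real.sqrt (1 + Real.cos (u τ) ^ 2) * w τ)) τ
  deriv_w : ∀ τ, HasDerivAt w (φ τ * (-(1 / 2) * (1 + s τ) * v τ * w τ * Real.cos (u τ) ^ 2
      + 1 / 2 * Real.sqrt (1 + Real.cos (u τ) ^ 2) * (1 - s τ) * deriv (Wpot m3) (u τ)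
      + 1 / 2 * (v τ ^ 2 - 2 * h * s τ) * Real.sqrt (1 + Real.cos (u τ) ^ 2)
          * Real.sin (u τ) * Real.cos (u τ))) τ

lemma HasDerivAt.isRescaledSolution {m3 h : ℝ} {φ : ℝ → ℝ} {γ : ℝ → ℝ × ℝ × ℝ × ℝ}
    (hγ : ∀ t, HasDerivAt γ (φ t • blownUpField m3 h (γ t)) t) :
    IsRescaledSolution m3 h φ (fun t ↦ (γ t).1) (fun t ↦ (γ t).2.1) (fun t ↦ (γ t).2.2.1)
      (fun t ↦ (γ t).2.2.2) where
  deriv_s t := (hγ t).fst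
  deriv_v t := (hγ t).snd.fst
  deriv_u t := (hγ t).snd.snd.fst
  deriv_w t := (hγ t).snd.snd.snd

namespace IsRescaledSolution

variable {m3 h : ℝ} {φ s v u w : ℝ → ℝ}

lemma continuous_s (H : IsRescaledSolution m3 h φ s v u w) : Continuous s :=
  continuous_iff_continuousAt.2 fun t ↦ (H.deriv_s t).continuousAt

lemma continuous_v (H : IsRescaledSolution m3 h φ s v u w) : Continuous v :=
  continuous_iff_continuousAt.2 fun t ↦ (H.deriv_v t).continuousAt

lemma continuous_u (H : IsRescaledSolution m3 h φ s v u w) : Continuous u :=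
  continuous_iff_continuousAt.2 fun t ↦ (H.deriv_u t).continuousAt

lemma s_nonneg (H : IsRescaledSolution m3 h φ s v u w) (hφ : Continuous φ) (h0 : 0 ≤ s 0)
    (t : ℝ) : 0 ≤ s t := by
  have hs := H.continuous_s
  have hv := H.continuous_v
  have hu := H.continuous_u
  exact nonneg_of_hasDerivAt_mul (a := fun t ↦ φ t * (v t * (1 - s t) * Real.cos (u t) ^ 2))
    (by fun_prop) (fun t ↦ (H.deriv_s t).congr_deriv (by ring)) h0 t

lemma s_le_one (H : IsRescaledSolution m3 h φ s v u w) (hφ : Continuous φ) (h1 : s 0 ≤ 1)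
    (t : ℝ) : s t ≤ 1 := by
  have hs := H.continuous_s
  have hv := H.continuous_v
  have hu := H.continuous_u
  exact sub_nonneg.1 <| nonneg_of_hasDerivAt_mul (y := fun t ↦ 1 - s t)
    (a := fun t ↦ -(φ t * (v t * s t * Real.cos (u t) ^ 2)))
    (by fun_prop) (fun t ↦ ((H.deriv_s t).const_sub 1).congr_deriv (by ring)) (sub_nonneg.2 h1) t

lemma hasDerivAt_energyFn (H : IsRescaledSolution m3 h φ s v u w) (hm3 : 0 < m3) (t : ℝ) :
    HasDerivAt (fun t ↦ energyFn m3 h (s t) (v t) (u t) (w t))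
      (φ t * (v t * Real.cos (u t) ^ 2 * (1 - s t)) * energyFn m3 h (s t) (v t) (u t) (w t)) t := by
  have hW := (((contDiff_Wpot hm3 (n := 1)).differentiable one_ne_zero (u t)).hasDerivAt).comp t
    (H.deriv_u t)
  have hc := (H.deriv_u t).cos.pow 2
  have := (((((H.deriv_v t).pow 2).mul hc).add ((H.deriv_w t).pow 2)).const_mul (1 / 2)).sub
    (((H.deriv_s t).const_sub 1).mul hW) |>.sub (((H.deriv_s t).const_mul h).mul hc)
  refine this.congr_deriv ?_
  simp only [energyFn, Pi.pow_apply, Function.comp_apply]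
  push_cast
  ring

lemma energyFn_eq_zero (H : IsRescaledSolution m3 h φ s v u w) (hm3 : 0 < m3) (hφ : Continuous φ)
    (h0 : energyFn m3 h (s 0) (v 0) (u 0) (w 0) = 0) (t : ℝ) :
    energyFn m3 h (s t) (v t) (u t) (w t) = 0 := by
  have hs := H.continuous_s
  have hv := H.continuous_v
  have hu := H.continuous_u
  have ha : Continuous fun t ↦ φ t * (v t * Real.cos (u t) ^ 2 * (1 - s t)) := by fun_prop
  refine le_antisymm (neg_nonneg.1 ?_)
    (nonneg_of_hasDerivAt_mul ha (H.hasDerivAt_energyFn hm3) h0.ge t)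
  exact nonneg_of_hasDerivAt_mul ha
    (y := fun t ↦ -energyFn m3 h (s t) (v t) (u t) (w t))
    (fun t ↦ (H.hasDerivAt_energyFn hm3 t).neg.congr_deriv (by ring)) (by simp [h0]) t

/-- On the zero energy level the kinetic term is bounded in terms of a bound of the potential. -/
lemma kinetic_le (H : IsRescaledSolution m3 h φ s v u w) (hm3 : 0 < m3) (hφ : Continuous φ)
    (hs0 : 0 ≤ s 0) (hs1 : s 0 ≤ 1) (h0 : energyFn m3 h (s 0) (v 0) (u 0) (w 0) = 0)
    {B : ℝ} (hB : ∀ u, |Wpot m3 u| ≤ B) (t : ℝ) :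
    v t ^ 2 * Real.cos (u t) ^ 2 + w t ^ 2 ≤ 2 * (B + |h|) := by
  have hE := H.energyFn_eq_zero hm3 hφ h0 t
  have h1 := H.s_nonneg hφ hs0 t
  have h2 := H.s_le_one hφ hs1 t
  have hW : (1 - s t) * Wpot m3 (u t) ≤ B := by
    have := (abs_le.1 (hB (u t))).2
    nlinarith [(abs_nonneg _).trans (hB (u t))]
  have hh : h * s t * Real.cos (u t) ^ 2 ≤ |h| := by
    have h3 : s t * Real.cos (u t) ^ 2 ≤ 1 := mul_le_one₀ h2 (sq_nonneg _) (Real.cos_sq_le_one _)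
    calc h * s t * Real.cos (u t) ^ 2 = h * (s t * Real.cos (u t) ^ 2) := by ring
      _ ≤ |h| * (s t * Real.cos (u t) ^ 2) := by gcongr; exact le_abs_self h
      _ ≤ |h| * 1 := by gcongr
      _ = |h| := mul_one _
  unfold energyFn at hE
  linarith

/-- The a priori bounds on the zero energy level. -/
lemma abs_le_bounds (H : IsRescaledSolution m3 h φ s v u w) (hm3 : 0 < m3) (hφ : Continuous φ)
    (hφ01 : ∀ t, 0 ≤ φ t ∧ φ t ≤ 1)
    (hs0 : 0 ≤ s 0) (hs1 : s 0 ≤ 1) (h0 : energyFn m3 h (s 0) (v 0) (u 0) (w 0) = 0)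
    {B : ℝ} (hB : ∀ u, |Wpot m3 u| ≤ B) (t : ℝ) :
    |s t| ≤ 1 ∧ |v t| ≤ |v 0| + (3 * B + 2 * |h|) * |t| ∧
      |u t| ≤ |u 0| + (2 * (B + |h|) + 1) * |t| ∧ |w t| ≤ 2 * (B + |h|) + 1 := by
  have hK := H.kinetic_le hm3 hφ hs0 hs1 h0 hB
  have hs := H.s_nonneg hφ hs0
  have hs' := H.s_le_one hφ hs1
  have hB0 : 0 ≤ B := (abs_nonneg _).trans (hB 0)
  have hvc : ∀ t, 0 ≤ v t ^ 2 * Real.cos (u t) ^ 2 := fun t ↦ by positivity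
  have hw : ∀ t, |w t| ≤ 2 * (B + |h|) + 1 := fun t ↦ by
    nlinarith [hK t, hvc t, sq_abs (w t), sq_nonneg (|w t| - 1)]
  have hscale : ∀ (t x C : ℝ), |x| ≤ C → |φ t * x| ≤ C := fun t x C hx ↦ by
    rw [abs_mul, abs_of_nonneg (hφ01 t).1]
    exact (mul_le_of_le_one_left (abs_nonneg x) (hφ01 t).2).trans hx
  have hv := abs_sub_le_of_abs_deriv_le (C := 3 * B + 2 * |h|) H.deriv_v (fun t ↦ by
    refine hscale t _ _ ?_
    have hW := abs_le.1 (hB (u t))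
    have h1 : |(1 - s t) * Wpot m3 (u t)| ≤ B := by
      rw [abs_mul, abs_of_nonneg (sub_nonneg.2 (hs' t))]
      exact (mul_le_of_le_one_left (abs_nonneg _) (by linarith [hs t])).trans (hB _)
    have h2 := abs_le.1 h1
    have h3 : 0 ≤ (1 - s t) * (v t ^ 2 * Real.cos (u t) ^ 2) :=
      mul_nonneg (sub_nonneg.2 (hs' t)) (hvc t)
    have h4 : 0 ≤ s t * (v t ^ 2 * Real.cos (u t) ^ 2) := mul_nonneg (hs t) (hvc t)
    rw [abs_le]
    constructor <;> nlinarith [hK t, hvc t, sq_nonneg (w t), abs_nonneg h]) t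
  have hu := abs_sub_le_of_abs_deriv_le (C := 2 * (B + |h|) + 1) H.deriv_u (fun t ↦ by
    refine hscale t _ _ ?_
    have hq : Real.sqrt (1 + Real.cos (u t) ^ 2) ≤ 2 :=
      Real.sqrt_le_iff.2 ⟨by norm_num, by linarith [Real.cos_sq_le_one (u t)]⟩
    rw [abs_mul, abs_of_nonneg (by positivity)]
    exact (mul_le_of_le_one_left (abs_nonneg _) (by linarith)).trans (hw t)) t
  refine ⟨abs_le.2 ⟨by linarith [hs t], hs' t⟩, ?_, ?_, hw t⟩
  · linarith [abs_sub_abs_le_abs_sub (v t) (v 0)]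
  · linarith [abs_sub_abs_le_abs_sub (u t) (u 0)]

end IsRescaledSolution

/-- Global existence on the energy level: for every energy `h` and every
initial point with `0 ≤ s0 ≤ 1` and `E(s0,v0,u0,w0) = 0`, there is a solution of the
regularized blown-up system defined for all `τ ∈ ℝ`, taking the given initial value at
`τ = 0` and with `0 ≤ s(τ) ≤ 1` for all `τ`. -/
theorem stmt1 (m3 h : ℝ) (hm3 : 0 < m3) (s0 v0 u0 w0 : ℝ)
    (hs0 : 0 ≤ s0) (hs1 : s0 ≤ 1) (hE : energyFn m3 h s0 v0 u0 w0 = 0) :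
    ∃ s v u w : ℝ → ℝ, IsSolution m3 h s v u w ∧
      s 0 = s0 ∧ v 0 = v0 ∧ u 0 = u0 ∧ w 0 = w0 ∧
      ∀ τ : ℝ, 0 ≤ s τ ∧ s τ ≤ 1 := by
  obtain ⟨B, hB⟩ := exists_abs_Wpot_le hm3
  have hB0 : 0 ≤ B := (abs_nonneg _).trans (hB 0)
  obtain ⟨γ, hγ0, hγ⟩ := exists_hasDerivAt_of_cutoff_bound (contDiff_blownUpField hm3 h)
    (s0, v0, u0, w0) fun T ↦ by
      refine ⟨1 + (|v0| + (3 * B + 2 * |h|) * |T|) + (|u0| + (2 * (B + |h|) + 1) * |T|)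
        + (2 * (B + |h|) + 1), fun φ γ hφ hφ01 hγ0 hγ t ht ↦ ?_⟩
      have hγc : Continuous γ := continuous_iff_continuousAt.2 fun t ↦ (hγ t).continuousAt
      have H := HasDerivAt.isRescaledSolution (φ := fun t ↦ φ (γ t)) hγ
      obtain ⟨bs, bv, bu, bw⟩ := H.abs_le_bounds hm3 (hφ.comp hγc) (fun t ↦ hφ01 _)
        (by simpa [hγ0] using hs0) (by simpa [hγ0] using hs1) (by simpa [hγ0] using hE) hB t
      simp only [hγ0] at bv bu
      have htT : |t| ≤ |T| := (abs_lt.2 ht).le.trans (le_abs_self T)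
      have hv : (3 * B + 2 * |h|) * |t| ≤ (3 * B + 2 * |h|) * |T| := by gcongr
      have hu : (2 * (B + |h|) + 1) * |t| ≤ (2 * (B + |h|) + 1) * |T| := by gcongr
      have pv : 0 ≤ (3 * B + 2 * |h|) * |T| := by positivity
      have pu : 0 ≤ (2 * (B + |h|) + 1) * |T| := by positivity
      simp only [Prod.norm_def, Real.norm_eq_abs, sup_le_iff]
      refine ⟨?_, ?_, ?_, ?_⟩ <;> linarith [abs_nonneg v0, abs_nonneg u0, abs_nonneg h]
  have H := HasDerivAt.isRescaledSolution (m3 := m3) (h := h) (φ := fun _ ↦ 1) (γ := γ)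
    fun t ↦ by simpa using hγ t
  refine ⟨_, _, _, _, ⟨fun t ↦ (hγ t).fst, fun t ↦ (hγ t).snd.fst,
    fun t ↦ (hγ t).snd.snd.fst, fun t ↦ (hγ t).snd.snd.snd⟩, ?_, ?_, ?_, ?_, fun t ↦
    ⟨H.s_nonneg continuous_const (by simpa [hγ0] using hs0) t,
      H.s_le_one continuous_const (by simpa [hγ0] using hs1) t⟩⟩ <;> simp [hγ0]
end

section
/- Along every solution (s,v,u,w) of the regularized blown-up system, the function F(tau) = E(s(tau),v(tau),u(tau),w(tau)) satisfies the identity F'(tau) = v(tau)*(1 - s(tau))*cos(u(tau))^2 * F(tau) for all tau. In particular, if F vanishes at one time then it vanishes at all times, so the energy level set {E = 0} is invariant under the flow. -/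
open Real Filter Topology MeasureTheory

lemma Wpot_radicand_pos {m3 : ℝ} (hm3 : 0 < m3) (u : ℝ) :
    0 < Real.cos u ^ 4 / 2 + (1 - Real.cos u ^ 4) / (2 * m3 / (2 + m3)) := by
  have hle : Real.cos u ^ 4 ≤ 1 := by nlinarith [Real.cos_sq_le_one u, sq_nonneg (Real.cos u)]
  have hmu : 0 < 2 * m3 / (2 + m3) := by positivity
  rcases hle.eq_or_lt with heq | hlt
  · rw [heq]
    norm_num
  · have hpos : 0 < (1 - Real.cos u ^ 4) / (2 * m3 / (2 + m3)) := div_pos (sub_pos.2 hlt) hmu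
    positivity

lemma differentiable_Wpot {m3 : ℝ} (hm3 : 0 < m3) : Differentiable ℝ (Wpot m3) := by
  intro u
  have hpos := Wpot_radicand_pos hm3 u
  unfold Wpot
  refine (differentiableAt_const _).add (DifferentiableAt.div (by fun_prop) ?_
    (Real.sqrt_pos.2 hpos).ne')
  exact DifferentiableAt.sqrt (by fun_prop) hpos.ne'

lemma IsSolution.hasDerivAt_energyFn {m3 h : ℝ} (hm3 : 0 < m3) {s v u w : ℝ → ℝ}
    (hsol : IsSolution m3 h s v u w) (τ : ℝ) :
    HasDerivAt (fun σ => energyFn m3 h (s σ) (v σ) (u σ) (w σ))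
      (v τ * (1 - s τ) * Real.cos (u τ) ^ 2 *
        energyFn m3 h (s τ) (v τ) (u τ) (w τ)) τ := by
  obtain ⟨hs, hv, hu, hw⟩ := hsol
  have hcos := ((hu τ).cos).pow 2
  have hW := (differentiable_Wpot hm3 (u τ)).hasDerivAt.comp τ (hu τ)
  have hkin := ((((hv τ).pow 2).mul hcos).add ((hw τ).pow 2)).const_mul (1 / 2)
  have hE := (hkin.sub (((hs τ).const_sub 1).mul hW)).sub (((hs τ).const_mul h).mul hcos)
  refine hE.congr_deriv ?_
  simp only [energyFn, Pi.pow_apply, Function.comp_apply]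
  push_cast
  ring

/-- A solution of a scalar homogeneous linear ODE with continuous coefficient which vanishes
somewhere vanishes identically. -/
lemma eq_zero_of_hasDerivAt_mul_self {f g : ℝ → ℝ} (hg : Continuous g)
    (hf : ∀ t, HasDerivAt f (g t * f t) t) {t₀ : ℝ} (h₀ : f t₀ = 0) (t : ℝ) : f t = 0 := by
  have hG (x : ℝ) : HasDerivAt (fun y => ∫ r in t₀..y, g r) (g x) x :=
    hg.integral_hasStrictDerivAt t₀ x |>.hasDerivAt
  have hconst (x : ℝ) : HasDerivAt (fun y => f y * Real.exp (-∫ r in t₀..y, g r)) 0 x :=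
    ((hf x).mul (hG x).neg.exp).congr_deriv (by simp only [Pi.neg_apply]; ring)
  have heq := is_const_of_deriv_eq_zero (fun x => (hconst x).differentiableAt)
    (fun x => (hconst x).deriv) t t₀
  simpa [h₀, Real.exp_ne_zero] using heq

/-- along every solution of the regularized blown-up system, the energy
`F(τ) = E(s(τ),v(τ),u(τ),w(τ))` satisfies `F' = v(1-s)cos²(u) · F`; in particular if `F`
vanishes at one time then it vanishes at all times, so `{E = 0}` is flow-invariant. -/
theorem stmt3 (m3 h : ℝ) (hm3 : 0 < m3) (s v u w : ℝ → ℝ)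
    (hsol : IsSolution m3 h s v u w) :
    (∀ τ : ℝ, HasDerivAt (fun σ => energyFn m3 h (s σ) (v σ) (u σ) (w σ))
      (v τ * (1 - s τ) * Real.cos (u τ) ^ 2 *
        energyFn m3 h (s τ) (v τ) (u τ) (w τ)) τ) ∧
    (∀ τ0 : ℝ, energyFn m3 h (s τ0) (v τ0) (u τ0) (w τ0) = 0 →
      ∀ τ : ℝ, energyFn m3 h (s τ) (v τ) (u τ) (w τ) = 0) := by
  have hF := hsol.hasDerivAt_energyFn hm3
  refine ⟨hF, fun τ0 h0 τ => eq_zero_of_hasDerivAt_mul_self ?_ hF h0 τ⟩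
  obtain ⟨hs, hv, hu, -⟩ := hsol
  have cs : Continuous s := continuous_iff_continuousAt.2 fun τ => (hs τ).continuousAt
  have cv : Continuous v := continuous_iff_continuousAt.2 fun τ => (hv τ).continuousAt
  have cu : Continuous u := continuous_iff_continuousAt.2 fun τ => (hu τ).continuousAt
  fun_prop
end

section
/- Let (s,v,u,w) be a solution of the regularized blown-up system satisfying the energy relation, and suppose at some time tau_c one has cos(u(tau_c)) = 0 and s(tau_c) < 1 (a regularized binary collision at finite size). Then w(tau_c)^2 = sqrt(2)*(1 - s(tau_c)) > 0, so u'(tau_c) is nonzero; consequently tau_c is an isolated zero of the function tau |-> cos(u(tau)), i.e. binary collision times are isolated. -/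
open Real Filter Topology MeasureTheory

/-- at a regularized binary collision time `τc` (`cos(u(τc)) = 0`) with
`s(τc) < 1`, one has `w(τc)² = √2·(1 - s(τc)) > 0`, so `u'(τc) ≠ 0`; consequently `τc`
is an isolated zero of `τ ↦ cos(u(τ))`, i.e. binary collision times are isolated. -/
theorem stmt4 (m3 h : ℝ) (hm3 : 0 < m3) (s v u w : ℝ → ℝ)
    (hsol : IsSolution m3 h s v u w) (hE : SatisfiesEnergy m3 h s v u w)
    (τc : ℝ) (hcos : Real.cos (u τc) = 0) (hs : s τc < 1) :
    w τc ^ 2 = Real.sqrt 2 * (1 - s τc) ∧ 0 < w τc ^ 2 ∧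
    deriv u τc ≠ 0 ∧
    ∃ ε > 0, ∀ τ : ℝ, τ ≠ τc → |τ - τc| < ε → Real.cos (u τ) ≠ 0 := by
  obtain ⟨-, -, hu, -⟩ := hsol
  have hsqrt : Real.sqrt 2 * Real.sqrt 2 = 2 := Real.mul_self_sqrt (by norm_num)
  have hsqrt_pos : 0 < Real.sqrt 2 := Real.sqrt_pos.2 (by norm_num)
  have hw : w τc ^ 2 = Real.sqrt 2 * (1 - s τc) := by
    have hE' := hE τc
    have hinv : 2 * (1 / Real.sqrt 2) = Real.sqrt 2 := by
      field_simp
      linear_combination -hsqrt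
    simp only [energyFn, Wpot, hcos, ne_eq, OfNat.ofNat_ne_zero, not_false_eq_true, zero_pow,
      mul_zero, zero_div] at hE'
    linear_combination 2 * hE' + (1 - s τc) * hinv
  have hw_pos : 0 < w τc ^ 2 := hw ▸ mul_pos hsqrt_pos (sub_pos.2 hs)
  have hw_ne : w τc ≠ 0 := pow_ne_zero_iff two_ne_zero |>.1 hw_pos.ne'
  have hu_ne : 1 / 2 * Real.sqrt (1 + Real.cos (u τc) ^ 2) * w τc ≠ 0 :=
    mul_ne_zero (by positivity) hw_ne
  have hsin : Real.sin (u τc) ≠ 0 := fun h0 => by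
    simpa [h0, hcos] using Real.sin_sq_add_cos_sq (u τc)
  refine ⟨hw, hw_pos, (hu τc).deriv ▸ hu_ne, ?_⟩
  have hev : ∀ᶠ τ in 𝓝[≠] τc, Real.cos (u τ) ≠ 0 :=
    (hu τc).cos.eventually_ne (mul_ne_zero (neg_ne_zero.2 hsin) hu_ne)
  rw [eventually_nhdsWithin_iff, Metric.eventually_nhds_iff] at hev
  obtain ⟨ε, hε, hball⟩ := hev
  exact ⟨ε, hε, fun τ hne hτ => hball (by rwa [Real.dist_eq]) hne⟩
end

section
/- Let h >= 0 and let (s,v,u,w) be a solution of the regularized blown-up system satisfying the energy relation with 0 <= s(tau) < 1 for all tau. If v(tau0) = 0 at some time tau0, then v'(tau0) = (1 - s(tau0))*W(u(tau0)) + 2*h*s(tau0)*cos(u(tau0))^2 > 0. Consequently the set {v > 0} is positively invariant and the set {v < 0} is negatively invariant: if v(tau0) >= 0 then v(tau) > 0 for all tau > tau0, and if v(tau0) <= 0 then v(tau) < 0 for all tau < tau0. -/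
open Real Filter Topology MeasureTheory

theorem Wpot_pos {m3 : ℝ} (hm3 : 0 < m3) (u : ℝ) : 0 < Wpot m3 u := by
  unfold Wpot
  positivity

/-- A differentiable function whose derivative is positive at each of its zeros
stays positive after any time at which it is nonnegative. -/
theorem pos_of_nonneg_of_deriv_pos_at_zeros {f f' : ℝ → ℝ} (hf : ∀ x, HasDerivAt f (f' x) x)
    (hpos : ∀ x, f x = 0 → 0 < f' x) {a b : ℝ} (ha : 0 ≤ f a) (hab : a < b) : 0 < f b := by
  have hcont : Continuous f := continuous_iff_continuousAt.2 fun x => (hf x).continuousAt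
  have hnonneg : ∀ x ∈ Set.Icc a b, 0 ≤ f x := by
    intro x hx
    have := image_le_of_deriv_right_lt_deriv_boundary (f := fun x => -f x) (f' := fun x => -f' x)
      (B := fun _ => 0) (B' := fun _ => 0) (a := a) (b := b) hcont.neg.continuousOn
      (fun x _ => (hf x).neg.hasDerivWithinAt) (by simpa using ha)
      (fun x => hasDerivAt_const x 0)
      (fun x _ hx => by simpa using hpos x (by simpa using hx)) hx
    simpa using this
  refine (hnonneg b ⟨hab.le, le_rfl⟩).lt_of_ne' fun hb => ?_
  have hsign := eventually_nhdsWithin_sign_eq_of_deriv_pos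
    ((hf b).deriv.symm ▸ hpos b hb) hb
  obtain ⟨x, hx, hxab⟩ :=
    ((hsign.filter_mono nhdsWithin_le_nhds).and (Ioo_mem_nhdsLT hab)).exists
  rw [sign_neg (sub_neg.2 hxab.2), sign_eq_neg_one_iff] at hx
  exact (hnonneg x ⟨hxab.1.le, hxab.2.le⟩).not_gt hx

/-- if `v(τ0) = 0` then `v'(τ0) = (1-s)W(u) + 2hs·cos²u > 0` at `τ0`;
consequently `{v > 0}` is positively invariant and `{v < 0}` is negatively invariant. -/
theorem stmt7 (m3 h : ℝ) (hm3 : 0 < m3) (hh : 0 ≤ h) (s v u w : ℝ → ℝ)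
    (hsol : IsSolution m3 h s v u w) (hE : SatisfiesEnergy m3 h s v u w)
    (hs : ∀ τ : ℝ, 0 ≤ s τ ∧ s τ < 1) :
    (∀ τ0 : ℝ, v τ0 = 0 →
      deriv v τ0 = (1 - s τ0) * Wpot m3 (u τ0) + 2 * h * s τ0 * Real.cos (u τ0) ^ 2 ∧
      0 < deriv v τ0) ∧
    (∀ τ0 τ : ℝ, 0 ≤ v τ0 → τ0 < τ → 0 < v τ) ∧
    (∀ τ0 τ : ℝ, v τ0 ≤ 0 → τ < τ0 → v τ < 0) := by
  have hv := hsol.2.1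
  have hzero : ∀ τ, v τ = 0 →
      deriv v τ = (1 - s τ) * Wpot m3 (u τ) + 2 * h * s τ * Real.cos (u τ) ^ 2 ∧
      0 < deriv v τ := by
    intro τ hτ
    have hderiv :
        deriv v τ = (1 - s τ) * Wpot m3 (u τ) + 2 * h * s τ * Real.cos (u τ) ^ 2 := by
      have hEτ := hE τ
      unfold energyFn at hEτ
      rw [(hv τ).deriv]
      rw [hτ] at hEτ ⊢
      linarith
    refine ⟨hderiv, hderiv ▸ ?_⟩
    have hW := mul_pos (sub_pos.2 (hs τ).2) (Wpot_pos hm3 (u τ))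
    have hs0 := (hs τ).1
    positivity
  have hpos : ∀ a b : ℝ, 0 ≤ v a → a < b → 0 < v b := fun a b ha hab =>
    pos_of_nonneg_of_deriv_pos_at_zeros (fun x => (hv x).differentiableAt.hasDerivAt)
      (fun x hx => (hzero x hx).2) ha hab
  exact ⟨hzero, hpos, fun a b ha hab => lt_of_not_ge fun hb => (hpos b a hb hab).not_ge ha⟩
end

section
/- Let h >= 0 and let (s,v,u,w) be a solution of the regularized blown-up system satisfying the energy relation with 0 < s(tau) < 1 for all tau. Define the classical time t(tau) = integral from 0 to tau of s(sigma)^(3/2)*(1-s(sigma))^(-1)*cos(u(sigma))^2 d sigma and the size r(tau) = s(tau)/(1-s(tau)). Then for all tau >= 0 one has the Lagrange-Jacobi estimate r(tau)^2 >= r(0)^2 + 2*v(0)*sqrt(r(0)*(1+r(0)))*t(tau) + 2*h*t(tau)^2. -/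
open Real Filter Topology MeasureTheory

theorem Wpot_nonneg {m3 : ℝ} (hm3 : 0 < m3) (u : ℝ) : 0 ≤ Wpot m3 u := by
  unfold Wpot
  positivity

theorem hasDerivAt_sqrt_div_one_sub {s : ℝ → ℝ} {s' τ : ℝ} (hs : HasDerivAt s s' τ)
    (h0 : 0 < s τ) (h1 : s τ < 1) :
    HasDerivAt (fun x => √(s x) / (1 - s x))
      (s' * (1 + s τ) / (2 * √(s τ) * (1 - s τ) ^ 2)) τ := by
  have h1' : 1 - s τ ≠ 0 := by linarith
  have hq : √(s τ) ≠ 0 := (Real.sqrt_pos.2 h0).ne'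
  refine ((hs.sqrt h0.ne').div (hs.const_sub 1) h1').congr_deriv ?_
  field_simp
  rw [Real.sq_sqrt h0.le]
  ring

/-- Half of the derivative of the moment of inertia with respect to classical time,
`v √s / (1 - s)`, differentiated along a solution on the zero level of the energy. -/
theorem IsSolution.hasDerivAt_mul_sqrt_div {m3 h : ℝ} {s v u w : ℝ → ℝ}
    (hsol : IsSolution m3 h s v u w) (hE : SatisfiesEnergy m3 h s v u w) {τ : ℝ}
    (h0 : 0 < s τ) (h1 : s τ < 1) :
    HasDerivAt (fun x => v x * (√(s x) / (1 - s x)))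
      (√(s τ) * Wpot m3 (u τ)
        + 2 * h * (s τ * √(s τ) / (1 - s τ) * Real.cos (u τ) ^ 2)) τ := by
  have h1' : 1 - s τ ≠ 0 := by linarith
  have hq : √(s τ) ≠ 0 := (Real.sqrt_pos.2 h0).ne'
  refine ((hsol.2.1 τ).mul (hasDerivAt_sqrt_div_one_sub (hsol.1 τ) h0 h1)).congr_deriv ?_
  have e := hE τ
  unfold energyFn at e
  have key : v τ * (v τ * s τ * (1 - s τ) * Real.cos (u τ) ^ 2 * (1 + s τ)
      / (2 * √(s τ) * (1 - s τ) ^ 2))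
      = v τ ^ 2 * Real.cos (u τ) ^ 2 * (1 + s τ) / 2 * (√(s τ) / (1 - s τ)) := by
    field_simp
    rw [Real.sq_sqrt h0.le]
    ring
  have hW : √(s τ) * Wpot m3 (u τ)
      = (1 - s τ) * Wpot m3 (u τ) * (√(s τ) / (1 - s τ)) := by
    field_simp
  rw [key, hW]
  linear_combination (2 * (√(s τ) / (1 - s τ))) * e

theorem sqrt_div_mul_one_add_div {x : ℝ} (h0 : 0 ≤ x) (h1 : x < 1) :
    √(x / (1 - x) * (1 + x / (1 - x))) = √x / (1 - x) := by
  have h : 0 < 1 - x := by linarith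
  rw [show x / (1 - x) * (1 + x / (1 - x)) = x / (1 - x) ^ 2 by field_simp; ring,
    Real.sqrt_div h0, Real.sqrt_sq h.le]

/-- with classical time `t(τ) = ∫₀^τ s^{3/2}(1-s)⁻¹cos²u dσ` and size
`r = s/(1-s)`, the Lagrange-Jacobi estimate
`r(τ)² ≥ r(0)² + 2v(0)√(r(0)(1+r(0)))·t(τ) + 2h·t(τ)²` holds for all `τ ≥ 0`. -/
theorem stmt9 (m3 h : ℝ) (hm3 : 0 < m3) (hh : 0 ≤ h) (s v u w : ℝ → ℝ)
    (hsol : IsSolution m3 h s v u w) (hE : SatisfiesEnergy m3 h s v u w)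
    (hs : ∀ τ : ℝ, 0 < s τ ∧ s τ < 1) :
    ∀ τ : ℝ, 0 ≤ τ →
      (s τ / (1 - s τ)) ^ 2 ≥ (s 0 / (1 - s 0)) ^ 2
        + 2 * v 0 * Real.sqrt (s 0 / (1 - s 0) * (1 + s 0 / (1 - s 0)))
          * (∫ σ in (0:ℝ)..τ, s σ * Real.sqrt (s σ) / (1 - s σ) * Real.cos (u σ) ^ 2)
        + 2 * h *
          (∫ σ in (0:ℝ)..τ, s σ * Real.sqrt (s σ) / (1 - s σ) * Real.cos (u σ) ^ 2) ^ 2 := by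
  obtain ⟨hs', -, hu', -⟩ := id hsol
  have hsc : Continuous s := continuous_iff_continuousAt.2 fun τ => (hs' τ).continuousAt
  have huc : Continuous u := continuous_iff_continuousAt.2 fun τ => (hu' τ).continuousAt
  have hne : ∀ τ, 1 - s τ ≠ 0 := fun τ => by linarith [(hs τ).2]
  set g : ℝ → ℝ := fun σ => s σ * Real.sqrt (s σ) / (1 - s σ) * Real.cos (u σ) ^ 2 with hg
  have hgc : Continuous g :=
    ((hsc.mul hsc.sqrt).div (continuous_const.sub hsc) hne).mul
      ((Real.continuous_cos.comp huc).pow 2)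
  have hg0 : ∀ τ, 0 ≤ g τ := fun τ =>
    mul_nonneg (div_nonneg (mul_nonneg (hs τ).1.le (Real.sqrt_nonneg _))
      (by linarith [(hs τ).2])) (sq_nonneg _)
  set t : ℝ → ℝ := fun τ => ∫ σ in (0:ℝ)..τ, g σ with ht
  have ht0 : t 0 = 0 := intervalIntegral.integral_same
  have ht' : ∀ τ, HasDerivAt t (g τ) τ := fun τ =>
    intervalIntegral.integral_hasDerivAt_right (hgc.intervalIntegrable _ _)
      (hgc.stronglyMeasurableAtFilter _ _) hgc.continuousAt
  have hJ : Monotone fun τ => v τ * (√(s τ) / (1 - s τ)) - 2 * h * t τ := by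
    refine monotone_of_hasDerivAt_nonneg (f' := fun τ => √(s τ) * Wpot m3 (u τ)) (fun τ => ?_)
      fun τ => mul_nonneg (Real.sqrt_nonneg _) (Wpot_nonneg hm3 _)
    refine ((hsol.hasDerivAt_mul_sqrt_div hE (hs τ).1 (hs τ).2).sub
      ((ht' τ).const_mul (2 * h))).congr_deriv ?_
    simp only [hg]
    ring
  set a : ℝ := v 0 * (√(s 0) / (1 - s 0)) with ha
  have hr : ∀ τ, HasDerivAt (fun τ => (s τ / (1 - s τ)) ^ 2)
      (2 * (v τ * (√(s τ) / (1 - s τ))) * g τ) τ := fun τ => by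
    have h1 := hne τ
    have hdiv : HasDerivAt (fun τ => s τ / (1 - s τ))
        (v τ * (s τ / (1 - s τ)) * Real.cos (u τ) ^ 2) τ := by
      refine ((hs' τ).div ((hs' τ).const_sub 1) h1).congr_deriv ?_
      field_simp
      ring
    refine (hdiv.pow 2).congr_deriv ?_
    have hsq := Real.sq_sqrt (hs τ).1.le
    simp only [hg, Nat.cast_ofNat, Nat.add_one_sub_one, pow_one]
    field_simp
    rw [hsq]
    ring
  have hF : ∀ τ, HasDerivAt
      (fun τ => (s τ / (1 - s τ)) ^ 2 - 2 * a * t τ - 2 * h * t τ ^ 2)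
      (2 * (v τ * (√(s τ) / (1 - s τ)) - 2 * h * t τ - a) * g τ) τ := fun τ => by
    refine (((hr τ).sub ((ht' τ).const_mul (2 * a))).sub
      (((ht' τ).pow 2).const_mul (2 * h))).congr_deriv ?_
    ring
  have hmono : MonotoneOn
      (fun τ => (s τ / (1 - s τ)) ^ 2 - 2 * a * t τ - 2 * h * t τ ^ 2) (Set.Ici 0) := by
    refine monotoneOn_of_hasDerivWithinAt_nonneg (convex_Ici 0)
      (fun τ _ => (hF τ).continuousAt.continuousWithinAt)
      (fun τ _ => (hF τ).hasDerivWithinAt) fun τ hτ => ?_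
    have hτ0 : 0 ≤ τ := interior_subset hτ
    have := hJ hτ0
    simp only [ht0, mul_zero, sub_zero] at this
    exact mul_nonneg (by linarith) (hg0 τ)
  intro τ hτ
  have hfin := hmono Set.self_mem_Ici hτ hτ
  simp only [ht0] at hfin
  rw [sqrt_div_mul_one_add_div (hs 0).1.le (hs 0).2, mul_assoc 2 (v 0), ← ha]
  change _ ≥ _ + 2 * a * t τ + 2 * h * t τ ^ 2
  linarith
end

section
/- Let h > 0 and let (s,v,u,w) be a solution of the regularized blown-up system satisfying the energy relation with 0 < s(tau) < 1 for all tau. Define the classical time t(tau) = integral from 0 to tau of s(sigma)^(3/2)*(1-s(sigma))^(-1)*cos(u(sigma))^2 d sigma. If v(tau) < 0 for all tau (the solution experiences a forward triple collision), then t(tau) converges to a finite limit as tau -> +infinity. If instead v(tau*) >= 0 for some tau* (no forward triple collision), then t(tau) -> +infinity as tau -> +infinity. -/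
open Real Filter Topology MeasureTheory

theorem sub_le_sub_of_hasDerivAt_le {f g f' g' : ℝ → ℝ} {a b : ℝ} (hab : a ≤ b)
    (hf : ∀ t, HasDerivAt f (f' t) t) (hg : ∀ t, HasDerivAt g (g' t) t)
    (hle : ∀ t, a ≤ t → f' t ≤ g' t) : f b - f a ≤ g b - g a := by
  have hd : ∀ t, HasDerivAt (fun t => g t - f t) (g' t - f' t) t := fun t => (hg t).sub (hf t)
  have hmono : MonotoneOn (fun t => g t - f t) (Set.Ici a) := by
    refine monotoneOn_of_deriv_nonneg (convex_Ici a)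
      (fun t _ => (hd t).continuousAt.continuousWithinAt)
      (fun t _ => (hd t).differentiableAt.differentiableWithinAt) fun t ht => ?_
    rw [(hd t).deriv]
    rw [interior_Ici] at ht
    linarith [hle t (le_of_lt ht)]
  have h := hmono (Set.self_mem_Ici) (Set.mem_Ici.2 hab) hab
  simp only at h
  linarith

theorem half_le_Wpot_denom {m3 : ℝ} (hm3 : 0 < m3) (u : ℝ) :
    1 / 2 ≤ cos u ^ 4 / 2 + (1 - cos u ^ 4) / (2 * m3 / (2 + m3)) := by
  have h1 : cos u ^ 4 ≤ 1 := by
    nlinarith [cos_sq_le_one u, sq_nonneg (cos u)]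
  have e : cos u ^ 4 / 2 + (1 - cos u ^ 4) / (2 * m3 / (2 + m3))
      = 1 / 2 + (1 - cos u ^ 4) / m3 := by
    field_simp; ring
  rw [e]
  have : 0 ≤ (1 - cos u ^ 4) / m3 := div_nonneg (by linarith) hm3.le
  linarith

theorem half_le_sqrt_of_half_le {D : ℝ} (hD : 1 / 2 ≤ D) : 1 / 2 ≤ √D :=
  Real.le_sqrt_of_sq_le (by linarith)

theorem half_le_Wpot {m3 : ℝ} (hm3 : 0 < m3) (u : ℝ) : 1 / 2 ≤ Wpot m3 u := by
  have h1 : (1 : ℝ) / 2 ≤ 1 / √2 :=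
    one_div_le_one_div_of_le (by positivity) (Real.sqrt_le_iff.2 (by norm_num))
  unfold Wpot
  have : 0 ≤ 2 * m3 * cos u ^ 2 /
      √(cos u ^ 4 / 2 + (1 - cos u ^ 4) / (2 * m3 / (2 + m3))) := by positivity
  linarith

theorem Wpot_le {m3 : ℝ} (hm3 : 0 < m3) (u : ℝ) : Wpot m3 u ≤ 1 + 4 * m3 := by
  have h1 : (1 : ℝ) / √2 ≤ 1 :=
    (div_le_one (by positivity)).2 (Real.le_sqrt_of_sq_le (by norm_num))
  have h2 := half_le_sqrt_of_half_le (half_le_Wpot_denom hm3 u)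
  unfold Wpot
  have : 2 * m3 * cos u ^ 2 /
      √(cos u ^ 4 / 2 + (1 - cos u ^ 4) / (2 * m3 / (2 + m3))) ≤ 4 * m3 := by
    rw [div_le_iff₀ (by linarith)]
    nlinarith [mul_le_mul_of_nonneg_left (cos_sq_le_one u) hm3.le]
  linarith

/-- The derivative of the shape potential vanishes at least linearly in `cos u`. -/
theorem exists_deriv_Wpot_eq_cos_mul {m3 : ℝ} (hm3 : 0 < m3) (u : ℝ) :
    ∃ g : ℝ, deriv (Wpot m3) u = cos u * g ∧ |g| ≤ 8 * m3 + 16 := by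
  set D := cos u ^ 4 / 2 + (1 - cos u ^ 4) / (2 * m3 / (2 + m3)) with hDdef
  have hD : 1 / 2 ≤ D := half_le_Wpot_denom hm3 u
  have hq : 1 / 2 ≤ √D := half_le_sqrt_of_half_le hD
  have hq0 : √D ≠ 0 := by linarith
  have hqq : √D * √D = D := Real.mul_self_sqrt (by linarith)
  have hd1 : HasDerivAt
      (fun u => cos u ^ 4 / 2 + (1 - cos u ^ 4) / (2 * m3 / (2 + m3)))
      (4 * cos u ^ 3 * sin u / m3) u := by
    have h4 := (hasDerivAt_cos u).fun_pow 4
    refine ((h4.div_const 2).fun_add ((h4.const_sub 1).div_const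
      (2 * m3 / (2 + m3)))).congr_deriv ?_
    field_simp
    push_cast
    ring
  have hd2 := hd1.sqrt (by rw [← hDdef]; linarith)
  rw [← hDdef] at hd2
  have hd3 : HasDerivAt (Wpot m3)
      (cos u * (-(4 * m3 * (sin u / √D)) - 4 * (cos u ^ 4 * sin u / (D * √D)))) u := by
    have h2 := ((hasDerivAt_cos u).fun_pow 2).const_mul (2 * m3)
    refine ((h2.fun_div hd2 hq0).const_add (1 / √2)).congr_deriv ?_
    rw [← hDdef]
    generalize √D = r at hq0 hqq ⊢
    rw [← hqq]
    field_simp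
    push_cast
    ring
  refine ⟨_, hd3.deriv, ?_⟩
  have b1 : |sin u / √D| ≤ 2 := by
    rw [abs_div, abs_of_pos (by linarith : 0 < √D), div_le_iff₀ (by linarith)]
    linarith [abs_sin_le_one u]
  have b2 : |cos u ^ 4 * sin u / (D * √D)| ≤ 4 := by
    have hp : 1 / 4 ≤ D * √D := by nlinarith
    rw [abs_div, abs_of_pos (by linarith : 0 < D * √D), div_le_iff₀ (by linarith), abs_mul,
      abs_pow]
    have : |cos u| ^ 4 * |sin u| ≤ 1 * 1 :=
      mul_le_mul (pow_le_one₀ (abs_nonneg _) (abs_cos_le_one u)) (abs_sin_le_one u)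
        (abs_nonneg _) zero_le_one
    linarith
  rw [abs_le] at *
  constructor <;> nlinarith

section Solution

variable {m3 h : ℝ} {s v u w : ℝ → ℝ}

theorem IsSolution.hasDerivAt_v (hsol : IsSolution m3 h s v u w)
    (hE : SatisfiesEnergy m3 h s v u w) (τ : ℝ) :
    HasDerivAt v (1 / 2 * w τ ^ 2 + s τ * cos (u τ) ^ 2 * (h - v τ ^ 2 / 2)) τ := by
  refine (hsol.2.1 τ).congr_deriv ?_
  have := hE τ
  unfold energyFn at this
  linarith

theorem IsSolution.hasDerivAt_sqrt_s (hsol : IsSolution m3 h s v u w)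
    (hs : ∀ τ, 0 < s τ ∧ s τ < 1) (τ : ℝ) :
    HasDerivAt (fun τ => √(s τ)) (1 / 2 * √(s τ) * v τ * (1 - s τ) * cos (u τ) ^ 2) τ := by
  have h0 := (hs τ).1
  have hq : 0 < √(s τ) := Real.sqrt_pos.2 h0
  refine ((hsol.1 τ).sqrt h0.ne').congr_deriv ?_
  rw [div_eq_iff (by positivity)]
  have : √(s τ) ^ 2 = s τ := Real.sq_sqrt h0.le
  linear_combination (-v τ * (1 - s τ) * cos (u τ) ^ 2) * this

/-- The Lagrange–Jacobi identity: half the classical-time derivative of the moment of inertia. -/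
theorem IsSolution.hasDerivAt_inertia (hsol : IsSolution m3 h s v u w)
    (hE : SatisfiesEnergy m3 h s v u w) (hs : ∀ τ, 0 < s τ ∧ s τ < 1) (τ : ℝ) :
    HasDerivAt (fun τ => √(s τ) * v τ / (1 - s τ))
      (√(s τ) / (1 - s τ) *
        (1 / 2 * v τ ^ 2 * cos (u τ) ^ 2 + 1 / 2 * w τ ^ 2 + h * s τ * cos (u τ) ^ 2)) τ := by
  have h1 : 1 - s τ ≠ 0 := by linarith [(hs τ).2]
  refine (((hsol.hasDerivAt_sqrt_s hs τ).fun_mul (hsol.hasDerivAt_v hE τ)).fun_div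
    ((hsol.1 τ).const_sub 1) h1).congr_deriv ?_
  field_simp
  ring

/-- The linear momentum of the third body relative to the binary changes only through the
shape potential. -/
theorem IsSolution.hasDerivAt_momentum (hsol : IsSolution m3 h s v u w)
    (hE : SatisfiesEnergy m3 h s v u w) (hs : ∀ τ, 0 < s τ ∧ s τ < 1) (τ : ℝ) :
    HasDerivAt
      (fun τ => (v τ * (sin (u τ) * √(1 + cos (u τ) ^ 2)) + w τ * cos (u τ)) / √(s τ))
      (1 / 2 * (1 - s τ) * √(1 + cos (u τ) ^ 2) * cos (u τ) * deriv (Wpot m3) (u τ) / √(s τ))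
      τ := by
  have hpos : 0 < √(s τ) := Real.sqrt_pos.2 (hs τ).1
  have hq : 0 < √(1 + cos (u τ) ^ 2) := by positivity
  have hqq : √(1 + cos (u τ) ^ 2) ^ 2 = 1 + cos (u τ) ^ 2 := Real.sq_sqrt (by positivity)
  have hu := hsol.2.2.1 τ
  have hroot : HasDerivAt (fun τ => √(1 + cos (u τ) ^ 2))
      (-(1 / 2) * cos (u τ) * sin (u τ) * w τ) τ := by
    refine (((hu.cos.fun_pow 2).const_add 1).sqrt (by positivity)).congr_deriv ?_
    field_simp
    push_cast
    ring
  refine ((((hsol.hasDerivAt_v hE τ).fun_mul (hu.sin.fun_mul hroot)).fun_add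
    ((hsol.2.2.2 τ).fun_mul hu.cos)).fun_div (hsol.hasDerivAt_sqrt_s hs τ)
      hpos.ne').congr_deriv ?_
  rw [div_eq_div_iff (by positivity) hpos.ne']
  have hsc := sin_sq_add_cos_sq (u τ)
  generalize √(1 + cos (u τ) ^ 2) = q at *
  generalize √(s τ) = p at *
  generalize deriv (Wpot m3) (u τ) = W' at *
  generalize cos (u τ) = x at *
  generalize sin (u τ) = y at *
  linear_combination (p ^ 2 * (1 / 2 * v τ * w τ * x)) * hqq
    - (p ^ 2 * (1 / 2 * v τ * w τ * x)) * hsc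

theorem kinetic_le (hm3 : 0 < m3) (hh : 0 < h)
    (hE : SatisfiesEnergy m3 h s v u w) (hs : ∀ τ, 0 < s τ ∧ s τ < 1) (τ : ℝ) :
    v τ ^ 2 * cos (u τ) ^ 2 + w τ ^ 2 ≤ 2 * (1 + 4 * m3 + h) := by
  have hEτ := hE τ
  unfold energyFn at hEτ
  obtain ⟨h0, h1⟩ := hs τ
  have hW := Wpot_le hm3 (u τ)
  have hW0 := half_le_Wpot hm3 (u τ)
  have hc := cos_sq_le_one (u τ)
  have e1 : (1 - s τ) * Wpot m3 (u τ) ≤ 1 * (1 + 4 * m3) :=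
    mul_le_mul (by linarith) hW (by linarith) zero_le_one
  have e2 : h * s τ * cos (u τ) ^ 2 ≤ h * 1 * 1 := by gcongr
  linarith

end Solution

/-- for `h > 0` and `0 < s < 1`, the classical time
`t(τ) = ∫₀^τ s^{3/2}(1-s)⁻¹cos²u dσ` converges to a finite limit as `τ → +∞` if the
solution experiences a forward triple collision (`v < 0` for all `τ`), and tends to `+∞`
otherwise (if `v(τ*) ≥ 0` for some `τ*`). -/
theorem stmt10 (m3 h : ℝ) (hm3 : 0 < m3) (hh : 0 < h) (s v u w : ℝ → ℝ)
    (hsol : IsSolution m3 h s v u w) (hE : SatisfiesEnergy m3 h s v u w)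
    (hs : ∀ τ : ℝ, 0 < s τ ∧ s τ < 1) :
    ((∀ τ : ℝ, v τ < 0) →
      ∃ L : ℝ, Tendsto
        (fun τ => ∫ σ in (0:ℝ)..τ, s σ * Real.sqrt (s σ) / (1 - s σ) * Real.cos (u σ) ^ 2)
        atTop (nhds L)) ∧
    ((∃ τs : ℝ, 0 ≤ v τs) →
      Tendsto
        (fun τ => ∫ σ in (0:ℝ)..τ, s σ * Real.sqrt (s σ) / (1 - s σ) * Real.cos (u σ) ^ 2)
        atTop atTop) := by
  have hsc : Continuous s := continuous_iff_continuousAt.2 fun τ => (hsol.1 τ).continuousAt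
  have huc : Continuous u := continuous_iff_continuousAt.2 fun τ => (hsol.2.2.1 τ).continuousAt
  have hs1 : ∀ τ, 1 - s τ ≠ 0 := fun τ => by linarith [(hs τ).2]
  have htc : Continuous fun σ => s σ * √(s σ) / (1 - s σ) * cos (u σ) ^ 2 := by
    fun_prop (disch := exact hs1)
  set T := fun τ => ∫ σ in (0:ℝ)..τ, s σ * √(s σ) / (1 - s σ) * cos (u σ) ^ 2 with hT
  have hTd : ∀ τ, HasDerivAt T (s τ * √(s τ) / (1 - s τ) * cos (u τ) ^ 2) τ := fun τ =>
    intervalIntegral.integral_hasDerivAt_right (htc.intervalIntegrable _ _)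
      (htc.stronglyMeasurableAtFilter _ _) htc.continuousAt
  have hTd0 : ∀ τ, 0 ≤ s τ * √(s τ) / (1 - s τ) * cos (u τ) ^ 2 := fun τ =>
    mul_nonneg (div_nonneg (mul_nonneg (hs τ).1.le (Real.sqrt_nonneg _))
      (by linarith [(hs τ).2])) (sq_nonneg _)
  have hTmono : Monotone T := monotone_of_hasDerivAt_nonneg hTd hTd0
  have hJ : ∀ a b, a ≤ b → h * T b - h * T a ≤
      √(s b) * v b / (1 - s b) - √(s a) * v a / (1 - s a) := fun a b hab =>
    sub_le_sub_of_hasDerivAt_le hab (fun τ => (hTd τ).const_mul h)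
      (hsol.hasDerivAt_inertia hE hs) fun τ _ => by
        have : 0 ≤ √(s τ) / (1 - s τ) := div_nonneg (Real.sqrt_nonneg _) (by linarith [(hs τ).2])
        have h2 : h * (s τ * √(s τ) / (1 - s τ) * cos (u τ) ^ 2) =
          √(s τ) / (1 - s τ) * (h * s τ * cos (u τ) ^ 2) := by ring
        rw [h2]
        refine mul_le_mul_of_nonneg_left ?_ this
        have := sq_nonneg (v τ * cos (u τ))
        rw [mul_pow] at this
        nlinarith [sq_nonneg (w τ)]
  refine ⟨fun hv => ?_, fun ⟨a, ha⟩ => ?_⟩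
  · rcases tendsto_atTop_of_monotone hTmono with htop | hlim
    · obtain ⟨b, hb0, hb⟩ := ((eventually_ge_atTop (0:ℝ)).and (htop.eventually_gt_atTop
        (T 0 - √(s 0) * v 0 / (1 - s 0) / h))).exists
      have h1 := hJ 0 b hb0
      have h2 : √(s b) * v b / (1 - s b) ≤ 0 :=
        div_nonpos_of_nonpos_of_nonneg
          (mul_nonpos_of_nonneg_of_nonpos (Real.sqrt_nonneg _) (hv b).le) (by linarith [(hs b).2])
      have h3 := mul_lt_mul_of_pos_left hb hh
      rw [mul_sub, mul_div_cancel₀ _ hh.ne'] at h3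
      linarith
    · exact hlim
  · rcases tendsto_atTop_of_monotone hTmono with htop | ⟨L, hlim⟩
    · exact htop
    exfalso
    have hTL : ∀ τ, T τ ≤ L := hTmono.ge_of_tendsto hlim
    have hv0 : ∀ τ, a ≤ τ → 0 ≤ v τ := fun τ hτ => by
      by_contra! hneg
      have h1 := hJ a τ hτ
      have h2 : √(s τ) * v τ / (1 - s τ) < 0 :=
        div_neg_of_neg_of_pos
          (mul_neg_of_pos_of_neg (Real.sqrt_pos.2 (hs τ).1) hneg) (by linarith [(hs τ).2])
      have h3 : 0 ≤ √(s a) * v a / (1 - s a) :=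
        div_nonneg (mul_nonneg (Real.sqrt_nonneg _) ha) (by linarith [(hs a).2])
      have h4 := mul_le_mul_of_nonneg_left (hTmono hτ) hh.le
      linarith
    have hsa : ∀ τ, a ≤ τ → s a ≤ s τ := fun τ hτ => by
      have := sub_le_sub_of_hasDerivAt_le hτ (fun t => hasDerivAt_const t (0:ℝ)) hsol.1
        fun t ht => mul_nonneg (mul_nonneg (mul_nonneg (hv0 t ht) (hs t).1.le)
          (by linarith [(hs t).2])) (sq_nonneg _)
      linarith
    have hsa0 := (hs a).1
    have hqa : 0 < √(s a) := Real.sqrt_pos.2 hsa0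
    have hcc : Continuous fun σ => cos (u σ) ^ 2 := by fun_prop
    set C := fun τ => ∫ σ in a..τ, cos (u σ) ^ 2 with hC
    have hCd : ∀ τ, HasDerivAt C (cos (u τ) ^ 2) τ := fun τ =>
      intervalIntegral.integral_hasDerivAt_right (hcc.intervalIntegrable _ _)
        (hcc.stronglyMeasurableAtFilter _ _) hcc.continuousAt
    have hCa : C a = 0 := by simp [hC]
    obtain ⟨K, hK0, hK⟩ : ∃ K, 0 ≤ K ∧ ∀ τ, a ≤ τ → C τ ≤ K := by
      have hk : 0 < s a * √(s a) := mul_pos hsa0 hqa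
      refine ⟨(L - T a) / (s a * √(s a)), div_nonneg (by linarith [hTL a]) hk.le, fun τ hτ => ?_⟩
      rw [le_div_iff₀ hk]
      have := sub_le_sub_of_hasDerivAt_le hτ (fun t => (hCd t).const_mul (s a * √(s a))) hTd
        fun t ht => by
          refine mul_le_mul_of_nonneg_right ?_ (sq_nonneg _)
          have h1 : s a * √(s a) ≤ s t * √(s t) :=
            mul_le_mul (hsa t ht) (Real.sqrt_le_sqrt (hsa t ht)) hqa.le (hs t).1.le
          rw [le_div_iff₀ (by linarith [(hs t).2])]
          nlinarith [(hs t).1]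
      rw [hCa] at this
      linarith [hTL τ]
    set P := fun τ => (v τ * (sin (u τ) * √(1 + cos (u τ) ^ 2)) + w τ * cos (u τ)) / √(s τ) with hP
    set k := (8 * m3 + 16) / √(s a) with hkdef
    have hk0 : 0 ≤ k := by positivity
    have hPd' : ∀ τ, a ≤ τ → |1 / 2 * (1 - s τ) * √(1 + cos (u τ) ^ 2) * cos (u τ) *
        deriv (Wpot m3) (u τ) / √(s τ)| ≤ k * cos (u τ) ^ 2 := fun τ hτ => by
      obtain ⟨g, hg, hgb⟩ := exists_deriv_Wpot_eq_cos_mul hm3 (u τ)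
      have hq : √(1 + cos (u τ) ^ 2) ≤ 2 :=
        Real.sqrt_le_iff.2 ⟨by norm_num, by linarith [cos_sq_le_one (u τ)]⟩
      have e : 1 / 2 * (1 - s τ) * √(1 + cos (u τ) ^ 2) * cos (u τ) *
          deriv (Wpot m3) (u τ) / √(s τ) =
          ((1 - s τ) * (1 / 2 * √(1 + cos (u τ) ^ 2))) * (g / √(s τ)) * cos (u τ) ^ 2 := by
        rw [hg]; ring
      rw [e, abs_mul, abs_of_nonneg (sq_nonneg (cos (u τ)))]
      refine mul_le_mul_of_nonneg_right ?_ (sq_nonneg _)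
      have h1 : |(1 - s τ) * (1 / 2 * √(1 + cos (u τ) ^ 2))| ≤ 1 := by
        rw [abs_of_nonneg (mul_nonneg (by linarith [(hs τ).2]) (by positivity))]
        exact mul_le_one₀ (by linarith [(hs τ).1]) (by positivity) (by linarith)
      have h2 : |g / √(s τ)| ≤ k := by
        rw [abs_div, abs_of_nonneg (Real.sqrt_nonneg (s τ))]
        exact div_le_div₀ (by positivity) hgb hqa (Real.sqrt_le_sqrt (hsa τ hτ))
      rw [abs_mul]
      calc _ ≤ 1 * k := mul_le_mul h1 h2 (abs_nonneg _) zero_le_one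
        _ = k := one_mul k
    have hPb : ∀ τ, a ≤ τ → |P τ| ≤ |P a| + k * K := fun τ hτ => by
      have hPd := hsol.hasDerivAt_momentum hE hs
      have h1 := sub_le_sub_of_hasDerivAt_le hτ hPd (fun t => (hCd t).const_mul k)
        fun t ht => (abs_le.1 (hPd' t ht)).2
      have h2 := sub_le_sub_of_hasDerivAt_le hτ (fun t => (hPd t).neg)
        (fun t => (hCd t).const_mul k)
        fun t ht => by linarith [(abs_le.1 (hPd' t ht)).1]
      simp only [Pi.neg_apply] at h2
      change P τ - P a ≤ _ at h1
      change -P τ - -P a ≤ _ at h2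
      rw [hCa] at h1 h2
      have h3 := mul_le_mul_of_nonneg_left (hK τ hτ) hk0
      have h4 := abs_le.1 (le_refl |P a|)
      exact abs_le.2 ⟨by linarith [h4.1], by linarith [h4.2]⟩
    obtain ⟨V, hV0, hV⟩ : ∃ V, 0 ≤ V ∧ ∀ τ, a ≤ τ → v τ ^ 2 ≤ V := by
      refine ⟨2 * (|P a| + k * K) ^ 2 + 6 * (1 + 4 * m3 + h), by positivity, fun τ hτ => ?_⟩
      have hkin := kinetic_le hm3 hh hE hs τ
      have hc := cos_sq_le_one (u τ)
      have hc0 := sq_nonneg (cos (u τ))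
      set N := v τ * (sin (u τ) * √(1 + cos (u τ) ^ 2)) + w τ * cos (u τ) with hN
      have hNP : N ^ 2 ≤ (|P a| + k * K) ^ 2 := by
        have hqs : 0 < √(s τ) := Real.sqrt_pos.2 (hs τ).1
        have e : N = P τ * √(s τ) := (div_mul_cancel₀ N hqs.ne').symm
        have e2 : N ^ 2 = |P τ| ^ 2 * s τ := by
          rw [e, mul_pow, Real.sq_sqrt (hs τ).1.le, sq_abs]
        have e3 : |P τ| ^ 2 ≤ (|P a| + k * K) ^ 2 := pow_le_pow_left₀ (abs_nonneg _) (hPb τ hτ) 2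
        rw [e2]
        nlinarith [(hs τ).2, sq_nonneg |P τ|]
      have e1 : v τ ^ 2 * (1 - cos (u τ) ^ 2) * (1 + cos (u τ) ^ 2) =
          (N - w τ * cos (u τ)) ^ 2 := by
        rw [hN, add_sub_cancel_right, mul_pow, mul_pow, Real.sq_sqrt (by positivity), sin_sq]
        ring
      have e2 : (N - w τ * cos (u τ)) ^ 2 ≤ 2 * N ^ 2 + 2 * (w τ ^ 2 * cos (u τ) ^ 2) := by
        nlinarith [sq_nonneg (N + w τ * cos (u τ))]
      have e3 : w τ ^ 2 * cos (u τ) ^ 2 ≤ w τ ^ 2 := mul_le_of_le_one_right (sq_nonneg _) hc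
      have e4 : v τ ^ 2 * cos (u τ) ^ 2 * cos (u τ) ^ 2 ≤ v τ ^ 2 * cos (u τ) ^ 2 :=
        mul_le_of_le_one_right (by positivity) hc
      have e5 : 0 ≤ v τ ^ 2 * cos (u τ) ^ 2 := by positivity
      nlinarith [sq_nonneg (w τ)]
    obtain ⟨δ, hδ, hsδ⟩ : ∃ δ, 0 < δ ∧ ∀ τ, a ≤ τ → δ ≤ 1 - s τ := by
      refine ⟨exp (log (1 - s a) - (1 + V) * K), exp_pos _, fun τ hτ => ?_⟩
      have hpos : 0 < 1 - s τ := by linarith [(hs τ).2]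
      rw [← Real.le_log_iff_exp_le hpos]
      have h1 := sub_le_sub_of_hasDerivAt_le hτ
        (fun t => (((hsol.1 t).const_sub 1).log (hs1 t)).neg)
        (fun t => (hCd t).const_mul (1 + V)) fun t ht => by
          have e : -(-(v t * s t * (1 - s t) * cos (u t) ^ 2) / (1 - s t)) =
              v t * s t * cos (u t) ^ 2 := by
            have := hs1 t
            field_simp
          rw [e]
          refine mul_le_mul_of_nonneg_right ?_ (sq_nonneg _)
          have h2 := hV t ht
          have h3 : v t * s t ≤ v t := mul_le_of_le_one_right (hv0 t ht) (hs t).2.le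
          nlinarith [sq_nonneg (v t - 1)]
      simp only [Pi.neg_apply] at h1
      rw [hCa] at h1
      have h3 := mul_le_mul_of_nonneg_left (hK τ hτ) (by linarith : 0 ≤ 1 + V)
      linarith
    have hlow : ∀ τ, a ≤ τ → δ / 2 * (τ - a) - V * K ≤ v τ := fun τ hτ => by
      have h1 := sub_le_sub_of_hasDerivAt_le hτ
        (fun t => ((hasDerivAt_id t).const_mul (δ / 2)).fun_sub ((hCd t).const_mul V))
        hsol.2.1 fun t ht => by
          have hEt := hE t
          unfold energyFn at hEt
          have hW := half_le_Wpot hm3 (u t)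
          have h2 : δ * (1 / 2) ≤ (1 - s t) * Wpot m3 (u t) :=
            mul_le_mul (hsδ t ht) hW (by norm_num) (by linarith [(hs t).2])
          have h3 := mul_le_mul_of_nonneg_right (hV t ht) (sq_nonneg (cos (u t)))
          have h4 : 0 ≤ h * s t * cos (u t) ^ 2 :=
            mul_nonneg (mul_nonneg hh.le (hs t).1.le) (sq_nonneg _)
          have h5 : s t * (v t ^ 2 * cos (u t) ^ 2) ≤ v t ^ 2 * cos (u t) ^ 2 :=
            mul_le_of_le_one_left (by positivity) (hs t).2.le
          linarith
      simp only [id] at h1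
      rw [hCa] at h1
      have h3 := mul_le_mul_of_nonneg_left (hK τ hτ) hV0
      linarith [hv0 a le_rfl]
    have hVK : 0 ≤ V * K := mul_nonneg hV0 hK0
    have hb0 : 0 ≤ 2 / δ * (V * K + V + 1) := by positivity
    have h1 := hlow (a + 2 / δ * (V * K + V + 1)) (by linarith)
    have h2 := hV (a + 2 / δ * (V * K + V + 1)) (by linarith)
    have e : δ / 2 * (a + 2 / δ * (V * K + V + 1) - a) = V * K + V + 1 := by
      field_simp
      ring
    rw [e] at h1
    nlinarith
end
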